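/- For all real numbers x and y, (1/(2π))·∫_{−∞}^{∞} e^{−(x−u)²/2 − (u−y)²/2} du + (1/(2√(2π)))·∫_{−∞}^{∞} (x−u)·sgn(u−y)·e^{−(x−u)²/2}·erfc(|u−y|/√2) du = −(1/√(2π))·e^{−(x−y)²/2} + (1/√π)·e^{−(x−y)²/4}. -/

import Mathlib

open MeasureTheory Real

/-- The complementary error function `erfc s = (2/√π) ∫_s^∞ e^{-t²} dt`. -/
noncomputable def erfc (s : ℝ) : ℝ := (2 / Real.sqrt π) * ∫ t in Set.Ioi s, Real.exp (-t ^ 2)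

open Filter Topology Set

lemma integrable_exp_neg_sq : Integrable fun t : ℝ => Real.exp (-t ^ 2) := by
  simpa using integrable_exp_neg_mul_sq (b := 1) one_pos

lemma erfc_nonneg (s : ℝ) : 0 ≤ erfc s :=
  mul_nonneg (by positivity) (integral_nonneg fun _ => (Real.exp_pos _).le)

lemma erfc_zero : erfc 0 = 1 := by
  have h := integral_gaussian_Ioi 1
  simp only [neg_mul, one_mul, div_one] at h
  have : Real.sqrt π ≠ 0 := by positivity
  rw [erfc, h]
  field_simp

lemma erfc_eq_sub_intervalIntegral (s : ℝ) :
    erfc s = 1 - (2 / Real.sqrt π) * ∫ t in (0 : ℝ)..s, Real.exp (-t ^ 2) := by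
  have h := intervalIntegral.integral_interval_add_Ioi
    (integrable_exp_neg_sq.integrableOn (s := Ioi 0))
    (integrable_exp_neg_sq.integrableOn (s := Ioi s))
  rw [← erfc_zero, erfc, erfc, ← h]
  ring

lemma hasDerivAt_erfc (s : ℝ) :
    HasDerivAt erfc (-(2 / Real.sqrt π) * Real.exp (-s ^ 2)) s := by
  have hc : Continuous fun t : ℝ => Real.exp (-t ^ 2) := by fun_prop
  have h := ((hc.integral_hasStrictDerivAt 0 s).hasDerivAt.const_mul
    (2 / Real.sqrt π)).const_sub 1
  rw [← neg_mul] at h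
  rwa [funext erfc_eq_sub_intervalIntegral]

lemma erfc_le_two (s : ℝ) : erfc s ≤ 2 := by
  have h : ∫ t in Ioi s, Real.exp (-t ^ 2) ≤ Real.sqrt π := by
    have h1 := integral_gaussian 1
    simp only [neg_mul, one_mul, div_one] at h1
    rw [← h1]
    exact setIntegral_le_integral integrable_exp_neg_sq (ae_of_all _ fun _ => (Real.exp_pos _).le)
  calc erfc s ≤ (2 / Real.sqrt π) * Real.sqrt π := by unfold erfc; gcongr
    _ = 2 := div_mul_cancel₀ _ (by positivity)

lemma continuous_erfc : Continuous erfc :=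
  continuous_iff_continuousAt.2 fun s => (hasDerivAt_erfc s).continuousAt

lemma integrable_sub_mul_exp_mul_erfc (a : ℝ) :
    Integrable fun t : ℝ =>
      (a - t) * Real.exp (-(a - t) ^ 2 / 2) * erfc (t / Real.sqrt 2) := by
  have h : Integrable fun t : ℝ => (a - t) * Real.exp (-(a - t) ^ 2 / 2) := by
    convert (integrable_mul_exp_neg_mul_sq (b := 1 / 2) (by norm_num)).comp_sub_left a using 4
    ring
  refine h.mul_bdd (c := 2) (continuous_erfc.comp
    (continuous_id.div_const _)).aestronglyMeasurable (ae_of_all _ fun t => ?_)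
  rw [Real.norm_of_nonneg (erfc_nonneg _)]
  exact erfc_le_two _

lemma gaussian_mul_gaussian_eq (a t : ℝ) :
    Real.exp (-(a - t) ^ 2 / 2 - t ^ 2 / 2) =
      Real.exp (-a ^ 2 / 4) * Real.exp (-1 * (t - a / 2) ^ 2) := by
  rw [← Real.exp_add]
  ring_nf

lemma integrable_gaussian_mul_gaussian (a : ℝ) :
    Integrable fun t : ℝ => Real.exp (-(a - t) ^ 2 / 2 - t ^ 2 / 2) := by
  simp_rw [gaussian_mul_gaussian_eq]
  exact ((integrable_exp_neg_mul_sq one_pos).comp_sub_right (a / 2)).const_mul _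

lemma integral_gaussian_mul_gaussian (a : ℝ) :
    ∫ t : ℝ, Real.exp (-(a - t) ^ 2 / 2 - t ^ 2 / 2) = Real.sqrt π * Real.exp (-a ^ 2 / 4) := by
  simp_rw [gaussian_mul_gaussian_eq]
  rw [integral_const_mul, integral_sub_right_eq_self (fun t => Real.exp (-1 * t ^ 2)),
    integral_gaussian, div_one, mul_comm]

lemma hasDerivAt_exp_neg_sub_sq (a t : ℝ) :
    HasDerivAt (fun t : ℝ => Real.exp (-(a - t) ^ 2 / 2))
      ((a - t) * Real.exp (-(a - t) ^ 2 / 2)) t := by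
  have h : HasDerivAt (fun t : ℝ => -(a - t) ^ 2 / 2) (a - t) t := by
    refine ((((hasDerivAt_id' t).const_sub a).fun_pow 2).fun_neg.div_const 2).congr_deriv ?_
    norm_num
  simpa only [mul_comm] using h.exp

lemma tendsto_exp_neg_sub_sq (a : ℝ) :
    Tendsto (fun t : ℝ => Real.exp (-(a - t) ^ 2 / 2)) atTop (𝓝 0) := by
  refine Real.tendsto_exp_atBot.comp ?_
  have h : Tendsto (fun t : ℝ => (t - a) ^ 2 / 2) atTop atTop :=
    ((tendsto_pow_atTop two_ne_zero).comp
      (tendsto_atTop_add_const_right _ (-a) tendsto_id)).atTop_div_const two_pos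
  convert tendsto_neg_atTop_atBot.comp h using 2 with t
  simp only [Function.comp_apply]
  ring

lemma integral_Ioi_sub_mul_exp_mul_erfc (a : ℝ) :
    ∫ t in Ioi (0 : ℝ), (a - t) * Real.exp (-(a - t) ^ 2 / 2) * erfc (t / Real.sqrt 2) =
      -Real.exp (-a ^ 2 / 2) + (2 / (Real.sqrt π * Real.sqrt 2)) *
        ∫ t in Ioi (0 : ℝ), Real.exp (-(a - t) ^ 2 / 2 - t ^ 2 / 2) := by
  have h1 := (integrable_sub_mul_exp_mul_erfc a).integrableOn (s := Ioi 0)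
  have h2 := ((integrable_gaussian_mul_gaussian a).const_mul
    (2 / (Real.sqrt π * Real.sqrt 2))).integrableOn (s := Ioi 0)
  have hd : ∀ t ∈ Ici (0 : ℝ), HasDerivAt
      (fun t => Real.exp (-(a - t) ^ 2 / 2) * erfc (t / Real.sqrt 2))
      ((a - t) * Real.exp (-(a - t) ^ 2 / 2) * erfc (t / Real.sqrt 2) -
        2 / (Real.sqrt π * Real.sqrt 2) * Real.exp (-(a - t) ^ 2 / 2 - t ^ 2 / 2)) t := by
    intro t _
    have he : HasDerivAt (fun t => erfc (t / Real.sqrt 2)) _ t :=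
      HasDerivAt.comp (h₂ := erfc) t (hasDerivAt_erfc (t / Real.sqrt 2))
      ((hasDerivAt_id' t).div_const (Real.sqrt 2))
    refine ((hasDerivAt_exp_neg_sub_sq a t).fun_mul he).congr_deriv ?_
    rw [div_pow, Real.sq_sqrt zero_le_two, sub_eq_add_neg (-(a - t) ^ 2 / 2), Real.exp_add,
      neg_div]
    field_simp
    ring
  have ht : Tendsto (fun t => Real.exp (-(a - t) ^ 2 / 2) * erfc (t / Real.sqrt 2))
      atTop (𝓝 0) := by
    refine squeeze_zero (fun t => mul_nonneg (Real.exp_pos _).le (erfc_nonneg _))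
      (fun t => mul_le_mul_of_nonneg_left (erfc_le_two _) (Real.exp_pos _).le) ?_
    simpa using (tendsto_exp_neg_sub_sq a).mul_const 2
  have h := integral_Ioi_of_hasDerivAt_of_tendsto' hd (h1.sub h2) ht
  rw [integral_sub h1 h2, integral_const_mul] at h
  simp only [sub_zero, zero_div, erfc_zero, mul_one] at h
  linarith

lemma integral_sub_mul_sign_mul_exp_mul_erfc (a : ℝ) :
    ∫ t : ℝ, (a - t) * Real.sign t * Real.exp (-(a - t) ^ 2 / 2) *
        erfc (|t| / Real.sqrt 2) =
      -2 * Real.exp (-a ^ 2 / 2) + (2 / (Real.sqrt π * Real.sqrt 2)) *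
        (Real.sqrt π * Real.exp (-a ^ 2 / 4)) := by
  set g : ℝ → ℝ := fun t => (a - t) * Real.sign t * Real.exp (-(a - t) ^ 2 / 2) *
        erfc (|t| / Real.sqrt 2) with hg
  have hpos : EqOn (fun t => (a - t) * Real.exp (-(a - t) ^ 2 / 2) * erfc (t / Real.sqrt 2)) g
      (Ioi 0) := by
    intro t (ht : 0 < t)
    simp [hg, Real.sign_of_pos ht, abs_of_pos ht]
  have hneg : EqOn (fun t => (-a - t) * Real.exp (-(-a - t) ^ 2 / 2) * erfc (t / Real.sqrt 2))
      (fun t => g (-t)) (Ioi 0) := by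
    intro t (ht : 0 < t)
    have hsq : (-a - t) ^ 2 = (a - -t) ^ 2 := by ring
    simp only [hg, Real.sign_of_neg (neg_lt_zero.2 ht), abs_neg, abs_of_pos ht, hsq]
    ring
  have hipos : IntegrableOn g (Ioi 0) :=
    (integrable_sub_mul_exp_mul_erfc a).integrableOn.congr_fun hpos measurableSet_Ioi
  have hineg : IntegrableOn g (Iic 0) := by
    rw [integrableOn_Iic_iff_integrableOn_Iio]
    have h := (integrable_sub_mul_exp_mul_erfc (-a)).integrableOn.congr_fun hneg measurableSet_Ioi
    simpa using h.comp_neg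
  have hG := integrable_gaussian_mul_gaussian a
  have hGneg : ∫ t in Ioi (0 : ℝ), Real.exp (-(-a - t) ^ 2 / 2 - t ^ 2 / 2) =
      ∫ t in Iic (0 : ℝ), Real.exp (-(a - t) ^ 2 / 2 - t ^ 2 / 2) := by
    have h := integral_comp_neg_Ioi 0 fun t : ℝ => Real.exp (-(a - t) ^ 2 / 2 - t ^ 2 / 2)
    rw [neg_zero] at h
    rw [← h]
    congr 1 with t
    ring_nf
  have hgneg := integral_comp_neg_Ioi 0 g
  rw [neg_zero, ← setIntegral_congr_fun measurableSet_Ioi hneg,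
    integral_Ioi_sub_mul_exp_mul_erfc, hGneg, neg_sq] at hgneg
  rw [← intervalIntegral.integral_Iic_add_Ioi hineg hipos,
    ← setIntegral_congr_fun measurableSet_Ioi hpos, integral_Ioi_sub_mul_exp_mul_erfc,
    ← hgneg, ← integral_gaussian_mul_gaussian,
    ← intervalIntegral.integral_Iic_add_Ioi hG.integrableOn hG.integrableOn]
  ring

/-- Evaluation of the `(1,1)`-component of `∫ K̃_{r,r}(x,u) K̃_{r,r}(u,y) du` for the
bulk-scaled real Ginibre kernel. -/
theorem stmt_14 (x y : ℝ) :
    (1 / (2 * π)) * (∫ u : ℝ, Real.exp (-(x - u) ^ 2 / 2 - (u - y) ^ 2 / 2)) +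
      (1 / (2 * Real.sqrt (2 * π))) *
        (∫ u : ℝ, (x - u) * Real.sign (u - y) * Real.exp (-(x - u) ^ 2 / 2) *
          erfc (|u - y| / Real.sqrt 2)) =
      -(1 / Real.sqrt (2 * π)) * Real.exp (-(x - y) ^ 2 / 2) +
        (1 / Real.sqrt π) * Real.exp (-(x - y) ^ 2 / 4) := by
  have h1 := integral_sub_right_eq_self (μ := volume)
    (fun t => Real.exp (-((x - y) - t) ^ 2 / 2 - t ^ 2 / 2)) y
  have h2 := integral_sub_right_eq_self (μ := volume)
    (fun t => ((x - y) - t) * Real.sign t * Real.exp (-((x - y) - t) ^ 2 / 2) *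
      erfc (|t| / Real.sqrt 2)) y
  simp only [sub_sub_sub_cancel_right] at h1 h2
  rw [h1, h2,
    integral_gaussian_mul_gaussian, integral_sub_mul_sign_mul_exp_mul_erfc,
    Real.sqrt_mul zero_le_two]
  have hp : Real.sqrt π ≠ 0 := by positivity
  have h2 : Real.sqrt 2 ≠ 0 := by positivity
  have hpp : π = Real.sqrt π ^ 2 := (Real.sq_sqrt pi_pos.le).symm
  have h22 : Real.sqrt 2 ^ 2 = 2 := Real.sq_sqrt zero_le_two
  have hc : 1 / (2 * π) = 1 / (2 * Real.sqrt π ^ 2) := by rw [← hpp]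
  rw [hc]
  field_simp
  ring_nf
  rw [h22]
  ring
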